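/- Stability transfer lemma: let K be a convex body in ℝⁿ for which the stability inequality holds (for every even continuous f ≥ 1 on K and ε > 0 with ∫_{K∩ξ⊥} f ≤ |K∩ξ⊥| + ε for all unit ξ, one has ∫_K f ≤ |K| + (n/(n−1)) cₙ |K|^{1/n} ε). Then for every measurable L ⊆ K and every even continuous non-negative g, ∫_L g ≤ (n/(n−1)) cₙ |K|^{1/n} · max_{ξ ∈ S^{n−1}} ∫_{L∩ξ⊥} g. -/

import Mathlib

open MeasureTheory
open scoped RealInnerProductSpace

lemma st_haar (n : ℕ) (hn : 2 ≤ n) (e : EuclideanSpace ℝ (Fin n)) (he : ‖e‖ = 1) :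
    (μH[(n : ℝ) - 1] : Measure (Submodule.span ℝ {e})ᗮ).IsAddHaarMeasure := by
  have h0 : e ≠ 0 := by
    intro h; simp [h] at he
  obtain ⟨m, rfl⟩ : ∃ m, n = m + 1 := ⟨n - 1, by omega⟩
  have : Fact (Module.finrank ℝ (EuclideanSpace ℝ (Fin (m + 1))) = m + 1) := ⟨by simp⟩
  have h1 := Submodule.finrank_orthogonal_span_singleton (𝕜 := ℝ) (n := m) h0
  have h2 := MeasureTheory.isAddHaarMeasure_hausdorffMeasure
    (E := (Submodule.span ℝ {e})ᗮ)
  rw [h1] at h2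
  have h3 : ((m + 1 : ℕ) : ℝ) - 1 = m := by push_cast; ring
  rw [h3]; exact h2

lemma st_section {n : ℕ} (d : ℝ) (hd : 0 ≤ d) (e : EuclideanSpace ℝ (Fin n))
    (R : EuclideanSpace ℝ (Fin n) →L[ℝ] EuclideanSpace ℝ (Fin n)) (hR : ∀ x, ‖R x‖ = ‖x‖)
    (K : Set (EuclideanSpace ℝ (Fin n))) (hK : MeasurableSet K)
    (F : EuclideanSpace ℝ (Fin n) → ℝ) :
    ∫ x in K ∩ {x | ⟪x, R e⟫ = 0}, F x ∂(μH[d])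
      = ∫ y : (Submodule.span ℝ {e})ᗮ, K.indicator F (R y) ∂(μH[d]) := by
  let T : EuclideanSpace ℝ (Fin n) →ₗᵢ[ℝ] EuclideanSpace ℝ (Fin n) := ⟨R.toLinearMap, hR⟩
  let J := T.comp (Submodule.span ℝ {e})ᗮ.subtypeₗᵢ
  have hJ : ∀ y, J y = R y := fun y => rfl
  have hsurj : Function.Surjective T :=
    (LinearMap.injective_iff_surjective (f := T.toLinearMap)).1 T.injective
  have hrange : Set.range J = {x | ⟪x, R e⟫ = 0} := by
    ext x
    simp only [Set.mem_range, Set.mem_ofPred_eq]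
    constructor
    · rintro ⟨y, rfl⟩
      have : ⟪T y, T e⟫ = 0 := by
        rw [T.inner_map_map]
        have := Submodule.mem_orthogonal_singleton_iff_inner_left.1 y.2
        exact this
      exact this
    · intro hx
      obtain ⟨z, rfl⟩ := hsurj x
      have h2 : ⟪T z, T e⟫ = 0 := hx
      rw [T.inner_map_map] at h2
      exact ⟨⟨z, Submodule.mem_orthogonal_singleton_iff_inner_left.2 h2⟩, rfl⟩
  rw [← hrange, ← Measure.restrict_restrict hK,
    ← J.isometry.map_hausdorffMeasure (Or.inl hd), ← integral_indicator hK,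
    J.isometry.isClosedEmbedding.measurableEmbedding.integral_map]
  rfl

lemma st_approx {n : ℕ} (A : Set (EuclideanSpace ℝ (Fin n))) (hA : IsClosed A) :
    ∃ φ : ℕ → EuclideanSpace ℝ (Fin n) → ℝ, (∀ k, Continuous (φ k)) ∧
      (∀ k x, 0 ≤ φ k x) ∧ (∀ k x, φ k x ≤ 1) ∧ (∀ k, ∀ x ∈ A, φ k x = 1) ∧
      (∀ x, Antitone fun k => φ k x) ∧
      (∀ x, Filter.Tendsto (fun k => φ k x) Filter.atTop (nhds (A.indicator 1 x))) ∧
      (∀ k, ∀ x ∉ Metric.thickening 1 A, φ k x = 0) := by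
  have hpos : ∀ k : ℕ, (0 : ℝ) < 1 / ((k : ℝ) + 1) := fun k => by positivity
  have hanti : ∀ x, Antitone fun k => ((thickenedIndicator (hpos k) A x : NNReal) : ℝ) := by
    intro x i j hij
    exact_mod_cast thickenedIndicator_mono (hpos j) (hpos i)
      (one_div_le_one_div_of_le (by positivity) (by exact_mod_cast Nat.succ_le_succ hij)) A x
  refine ⟨fun k x => (thickenedIndicator (hpos k) A x : NNReal), fun k => ?_, fun k x => ?_,
    fun k x => ?_, fun k x hx => ?_, hanti, fun x => ?_, fun k x hx => ?_⟩
  · exact NNReal.continuous_coe.comp (thickenedIndicator (hpos k) A).continuous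
  · exact NNReal.coe_nonneg _
  · exact_mod_cast thickenedIndicator_le_one (hpos k) A x
  · dsimp only
    rw [thickenedIndicator_one (hpos k) A hx, NNReal.coe_one]
  · have := tendsto_pi_nhds.1 (thickenedIndicator_tendsto_indicator_closure hpos
      tendsto_one_div_add_atTop_nhds_zero_nat A) x
    rw [hA.closure_eq] at this
    have h2 := (NNReal.continuous_coe.tendsto _).comp this
    have h3 : A.indicator (1 : EuclideanSpace ℝ (Fin n) → ℝ) x
        = ((A.indicator (fun _ => (1 : NNReal)) x : NNReal) : ℝ) := by
      by_cases h : x ∈ A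
      · rw [Set.indicator_of_mem h, Set.indicator_of_mem h]; simp
      · rw [Set.indicator_of_notMem h, Set.indicator_of_notMem h]; simp
    rw [h3]
    exact h2
  · refine le_antisymm ((hanti x (Nat.zero_le k)).trans ?_) (NNReal.coe_nonneg _)
    have : thickenedIndicator (hpos 0) A x = 0 := thickenedIndicator_zero _ _ (by simpa using hx)
    show ((thickenedIndicator (hpos 0) A x : NNReal) : ℝ) ≤ 0
    rw [this]; simp

lemma st_dini {n : ℕ} (V : Submodule ℝ (EuclideanSpace ℝ (Fin n)))
    (ν : Measure V) [ν.IsAddHaarMeasure]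
    (v : ℕ → EuclideanSpace ℝ (Fin n) → ℝ) (hv : ∀ k, Continuous (v k))
    (hanti : ∀ x, Antitone fun k => v k x)
    (w : EuclideanSpace ℝ (Fin n) → ℝ)
    (hlim : ∀ x, Filter.Tendsto (fun k => v k x) Filter.atTop (nhds (w x)))
    (M r : ℝ) (hbd : ∀ k x, ‖v k x‖ ≤ (Metric.closedBall 0 r).indicator (fun _ => M) x)
    (S : ℝ)
    (hS : ∀ R : EuclideanSpace ℝ (Fin n) →L[ℝ] EuclideanSpace ℝ (Fin n), (∀ x, ‖R x‖ = ‖x‖) →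
      ∫ y : V, w (R y) ∂ν ≤ S) (δ : ℝ) (hδ : 0 < δ) :
    ∃ k, ∀ R : EuclideanSpace ℝ (Fin n) →L[ℝ] EuclideanSpace ℝ (Fin n), (∀ x, ‖R x‖ = ‖x‖) →
      ∫ y : V, v k (R y) ∂ν < S + δ := by
  by_contra! hcon
  let b : V → ℝ := (Metric.closedBall 0 r).indicator (fun _ => M)
  have hb : Integrable b ν := by
    refine (integrable_indicator_iff measurableSet_closedBall).2 ?_
    exact continuousOn_const.integrableOn_compact (isCompact_closedBall _ _)
  let O : Set (EuclideanSpace ℝ (Fin n) →L[ℝ] EuclideanSpace ℝ (Fin n)) :=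
    {R | ∀ x, ‖R x‖ = ‖x‖}
  have hbv : ∀ k, ∀ R ∈ O, ∀ y : V, ‖v k (R y)‖ ≤ b y := by
    intro k R hR y
    refine (hbd k (R y)).trans (le_of_eq ?_)
    have := hR y
    by_cases h : ‖y‖ ≤ r
    · have h' : ‖(y : EuclideanSpace ℝ (Fin n))‖ ≤ r := h
      simp [b, h', this]
    · have h' : ¬ ‖(y : EuclideanSpace ℝ (Fin n))‖ ≤ r := h
      simp [b, h', this]
  have hmeas : ∀ k (R : EuclideanSpace ℝ (Fin n) →L[ℝ] EuclideanSpace ℝ (Fin n)),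
      AEStronglyMeasurable (fun y : V => v k (R y)) ν := fun k R =>
    ((hv k).comp (R.continuous.comp continuous_subtype_val)).aestronglyMeasurable
  have hOcl : IsClosed O := by
    have : O = ⋂ x, {R | ‖R x‖ = ‖x‖} := by ext; simp [O]
    rw [this]
    refine isClosed_iInter fun x => isClosed_eq ?_ continuous_const
    fun_prop
  have hOc : IsCompact O := by
    refine (isCompact_closedBall (0 : EuclideanSpace ℝ (Fin n) →L[ℝ] EuclideanSpace ℝ (Fin n)) 1).of_isClosed_subset hOcl ?_
    intro R hR
    rw [mem_closedBall_zero_iff]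
    exact R.opNorm_le_bound zero_le_one fun x => by rw [hR x, one_mul]
  have hcont : ∀ k, ContinuousOn
      (fun R : EuclideanSpace ℝ (Fin n) →L[ℝ] EuclideanSpace ℝ (Fin n) =>
        ∫ y : V, v k (R y) ∂ν) O := by
    intro k
    refine continuousOn_of_dominated (bound := b) (fun R _ => hmeas k R)
      (fun R hR => Filter.Eventually.of_forall (hbv k R hR)) hb
      (Filter.Eventually.of_forall fun y => ?_)
    refine Continuous.continuousOn ((hv k).comp ?_)
    fun_prop
  let C : ℕ → Set (EuclideanSpace ℝ (Fin n) →L[ℝ] EuclideanSpace ℝ (Fin n)) := fun k =>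
    O ∩ (fun R => ∫ y : V, v k (R y) ∂ν) ⁻¹' Set.Ici (S + δ)
  have hCcl : ∀ k, IsClosed (C k) := fun k =>
    (hcont k).preimage_isClosed_of_isClosed hOcl isClosed_Ici
  have hint : ∀ k, ∀ R ∈ O, Integrable (fun y : V => v k (R y)) ν := fun k R hR =>
    hb.mono' (hmeas k R) (Filter.Eventually.of_forall (hbv k R hR))
  obtain ⟨R, hR⟩ := IsCompact.nonempty_iInter_of_sequence_nonempty_isCompact_isClosed C
    (by
      rintro k R ⟨hR, h⟩
      refine ⟨hR, Set.mem_preimage.2 (Set.mem_Ici.2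
        (le_trans (Set.mem_Ici.1 (Set.mem_preimage.1 h)) ?_))⟩
      exact integral_mono (hint _ R hR) (hint _ R hR) fun y => hanti (R y) (Nat.le_succ k))
    (fun k => by
      obtain ⟨R, h1, h2⟩ := hcon k
      exact ⟨R, h1, h2⟩)
    (hOc.of_isClosed_subset (hCcl 0) Set.inter_subset_left) hCcl
  rw [Set.mem_iInter] at hR
  have hRO : R ∈ O := (hR 0).1
  have hl : Filter.Tendsto (fun k => ∫ y : V, v k (R y) ∂ν) Filter.atTop
      (nhds (∫ y : V, w (R y) ∂ν)) :=
    tendsto_integral_of_dominated_convergence b (fun k => hmeas k R) hb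
      (fun k => Filter.Eventually.of_forall (hbv k R hRO))
      (Filter.Eventually.of_forall fun y => hlim (R y))
  have := ge_of_tendsto' hl fun k => (hR k).2
  have := hS R hRO
  linarith

lemma st_int {n : ℕ} (V : Submodule ℝ (EuclideanSpace ℝ (Fin n)))
    (ν : Measure V) [ν.IsAddHaarMeasure]
    (R : EuclideanSpace ℝ (Fin n) →L[ℝ] EuclideanSpace ℝ (Fin n)) (hR : ∀ x, ‖R x‖ = ‖x‖)
    (D : Set (EuclideanSpace ℝ (Fin n))) (hD : MeasurableSet D) (r : ℝ)
    (hDr : ∀ x ∈ D, ‖x‖ ≤ r) (F : EuclideanSpace ℝ (Fin n) → ℝ) (hF : Continuous F) :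
    Integrable (fun y : V => D.indicator F (R y)) ν := by
  have hc : Continuous fun y : V => R y := R.continuous.comp continuous_subtype_val
  have h1 : (fun y : V => D.indicator F (R y))
      = ((fun y : V => R y) ⁻¹' D).indicator (fun y : V => F (R y)) := by
    ext y; rfl
  rw [h1, integrable_indicator_iff (hc.measurable hD)]
  refine ((hF.comp hc).continuousOn.integrableOn_compact
    (isCompact_closedBall (0 : V) r)).mono_set ?_
  intro y hy
  rw [mem_closedBall_zero_iff]
  have := hDr _ (Set.mem_preimage.1 hy)
  rw [hR] at this
  exact this

lemma st_inner {n : ℕ} (K P : Set (EuclideanSpace ℝ (Fin n))) (hK : IsCompact K)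
    (hP : MeasurableSet P) (hPK : P ⊆ K) (g : EuclideanSpace ℝ (Fin n) → ℝ)
    (hg : Continuous g) (δ : ℝ) (hδ : 0 < δ) :
    ∃ A ⊆ P, IsCompact A ∧ ∫ x in P, g x ≤ (∫ x in A, g x) + δ := by
  obtain ⟨M, hM⟩ := hK.exists_bound_of_continuousOn hg.continuousOn
  have hPfin : volume P ≠ ⊤ := ((measure_mono hPK).trans_lt hK.measure_lt_top).ne
  have hpos : 0 < δ / (|M| + 1) := by positivity
  obtain ⟨A, hAP, hA, hlt⟩ := hP.exists_isCompact_sdiff_lt hPfin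
    (ENNReal.ofReal_pos.2 hpos).ne'
  refine ⟨A, hAP, hA, ?_⟩
  have hI : IntegrableOn g P := (hg.continuousOn.integrableOn_compact hK).mono_set hPK
  have h1 := integral_inter_add_sdiff (μ := volume) (f := g) hA.measurableSet hI
  rw [Set.inter_eq_self_of_subset_right hAP] at h1
  have h2 := norm_setIntegral_le_of_norm_le_const (μ := volume) (s := P \ A) (f := g)
    (C := |M| + 1) (hlt.trans ENNReal.ofReal_lt_top)
    (fun x hx => (hM x (hPK hx.1)).trans ((le_abs_self M).trans (by linarith)))
  have h3 : volume.real (P \ A) ≤ δ / (|M| + 1) :=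
    ENNReal.toReal_le_of_le_ofReal hpos.le hlt.le
  have h4 : (|M| + 1) * volume.real (P \ A) ≤ δ := by
    calc _ ≤ (|M| + 1) * (δ / (|M| + 1)) := by gcongr
      _ = δ := by field_simp
  have := le_abs_self (∫ x in P \ A, g x)
  rw [Real.norm_eq_abs] at h2
  linarith

theorem stability_transfer (n : ℕ) (hn : 2 ≤ n)
    (K : Set (EuclideanSpace ℝ (Fin n)))
    (hKcompact : IsCompact K) (hKconvex : Convex ℝ K)
    (hK0 : (0 : EuclideanSpace ℝ (Fin n)) ∈ interior K)
    -- the stability inequality holds for K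
    (hstab : ∀ f : EuclideanSpace ℝ (Fin n) → ℝ, Continuous f → (∀ x, f (-x) = f x) →
      (∀ x ∈ K, 1 ≤ f x) → ∀ ε : ℝ, 0 < ε →
      (∀ ξ : EuclideanSpace ℝ (Fin n), ‖ξ‖ = 1 →
        ∫ x in K ∩ {x | ⟪x, ξ⟫ = 0}, f x ∂(μH[(n : ℝ) - 1])
          ≤ (μH[(n : ℝ) - 1] (K ∩ {x | ⟪x, ξ⟫ = 0})).toReal + ε) →
      ∫ x in K, f x ∂volume
        ≤ (volume K).toReal +
          ((n : ℝ) / (n - 1)) *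
            ((volume (Metric.closedBall (0 : EuclideanSpace ℝ (Fin n)) 1)).toReal ^
                (((n : ℝ) - 1) / n) /
              (volume (Metric.closedBall (0 : EuclideanSpace ℝ (Fin (n - 1))) 1)).toReal) *
            (volume K).toReal ^ ((1 : ℝ) / n) * ε)
    (L : Set (EuclideanSpace ℝ (Fin n))) (hL : MeasurableSet L) (hLK : L ⊆ K)
    (g : EuclideanSpace ℝ (Fin n) → ℝ)
    (hg_cont : Continuous g) (hg_even : ∀ x, g (-x) = g x) (hg_nonneg : ∀ x, 0 ≤ g x) :
    ∫ x in L, g x ∂volume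
      ≤ ((n : ℝ) / (n - 1)) *
          ((volume (Metric.closedBall (0 : EuclideanSpace ℝ (Fin n)) 1)).toReal ^
              (((n : ℝ) - 1) / n) /
            (volume (Metric.closedBall (0 : EuclideanSpace ℝ (Fin (n - 1))) 1)).toReal) *
          (volume K).toReal ^ ((1 : ℝ) / n) *
          (⨆ ξ : Metric.sphere (0 : EuclideanSpace ℝ (Fin n)) 1,
            ∫ x in L ∩ {x | ⟪x, (ξ : EuclideanSpace ℝ (Fin n))⟫ = 0},
              g x ∂(μH[(n : ℝ) - 1])) := by
  have hd : (0 : ℝ) ≤ (n : ℝ) - 1 := by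
    have : (2 : ℝ) ≤ n := by exact_mod_cast hn
    linarith
  generalize ((n : ℝ) / (n - 1)) *
          ((volume (Metric.closedBall (0 : EuclideanSpace ℝ (Fin n)) 1)).toReal ^
              (((n : ℝ) - 1) / n) /
            (volume (Metric.closedBall (0 : EuclideanSpace ℝ (Fin (n - 1))) 1)).toReal) *
          (volume K).toReal ^ ((1 : ℝ) / n) = C at hstab ⊢
  -- fixed unit vector and the model hyperplane
  obtain ⟨e, he⟩ : ∃ e : EuclideanSpace ℝ (Fin n), ‖e‖ = 1 :=
    ⟨EuclideanSpace.single ⟨0, by omega⟩ 1, by simp⟩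
  classical
  have := st_haar n hn e he
  have hrot : ∀ ξ : EuclideanSpace ℝ (Fin n), ‖ξ‖ = 1 →
      ∃ R : EuclideanSpace ℝ (Fin n) →L[ℝ] EuclideanSpace ℝ (Fin n),
        (∀ x, ‖R x‖ = ‖x‖) ∧ R e = ξ := by
    intro ξ hξ
    let Q := (Submodule.span ℝ {e - ξ})ᗮ.reflection
    refine ⟨Q.toContinuousLinearEquiv.toContinuousLinearMap, fun x => Q.norm_map x, ?_⟩
    exact Submodule.reflection_sub (he.trans hξ.symm)
  -- radius and bounds
  obtain ⟨r, hr⟩ : ∃ r, ∀ x ∈ Metric.thickening 1 K, ‖x‖ ≤ r := by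
    obtain ⟨r, hr⟩ := (hKcompact.isBounded.thickening (δ := 1)).subset_closedBall 0
    exact ⟨r, fun x hx => mem_closedBall_zero_iff.1 (hr hx)⟩
  have hKt : K ⊆ Metric.thickening 1 K := Metric.self_subset_thickening one_pos K
  have hKr : ∀ x ∈ K, ‖x‖ ≤ r := fun x hx => hr x (hKt hx)
  obtain ⟨M, hM⟩ := (isCompact_closedBall (0 : EuclideanSpace ℝ (Fin n)) r)
    |>.exists_bound_of_continuousOn hg_cont.continuousOn
  have hM' : ∀ x, ‖x‖ ≤ r → g x ≤ M := fun x hx =>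
    (le_abs_self _).trans (hM x (mem_closedBall_zero_iff.2 hx))
  have hKm : MeasurableSet K := hKcompact.measurableSet
  set V := (Submodule.span ℝ {e})ᗮ with hV
  set ν : Measure V := μH[(n : ℝ) - 1] with hν
  set S := ⨆ ξ : Metric.sphere (0 : EuclideanSpace ℝ (Fin n)) 1,
            ∫ x in L ∩ {x | ⟪x, (ξ : EuclideanSpace ℝ (Fin n))⟫ = 0},
              g x ∂(μH[(n : ℝ) - 1]) with hSdef
  have hLint : ∀ R : EuclideanSpace ℝ (Fin n) →L[ℝ] EuclideanSpace ℝ (Fin n),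
      (∀ x, ‖R x‖ = ‖x‖) → ∀ D : Set (EuclideanSpace ℝ (Fin n)), MeasurableSet D → D ⊆ K →
      Integrable (fun y : V => D.indicator g (R y)) ν := fun R hR D hD hDK =>
    st_int V ν R hR D hD r (fun x hx => hKr x (hDK hx)) g hg_cont
  have hb : Integrable ((Metric.closedBall (0 : V) r).indicator (fun _ => M)) ν := by
    refine (integrable_indicator_iff measurableSet_closedBall).2 ?_
    exact continuousOn_const.integrableOn_compact (isCompact_closedBall _ _)
  have hbdd : BddAbove (Set.range fun ξ : Metric.sphere (0 : EuclideanSpace ℝ (Fin n)) 1 =>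
      ∫ x in L ∩ {x | ⟪x, (ξ : EuclideanSpace ℝ (Fin n))⟫ = 0},
              g x ∂(μH[(n : ℝ) - 1])) := by
    refine ⟨∫ y : V, (Metric.closedBall (0 : V) r).indicator (fun _ => M) y ∂ν, ?_⟩
    rintro _ ⟨⟨ξ, hξ⟩, rfl⟩
    obtain ⟨R, hR, rfl⟩ := hrot ξ (by simpa using hξ)
    dsimp only
    rw [st_section _ hd e R hR L hL g]
    refine integral_mono (hLint R hR L hL hLK) hb fun y => ?_
    have hy : ‖R y‖ = ‖y‖ := hR y
    by_cases h : ‖y‖ ≤ r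
    · have h2 : y ∈ Metric.closedBall (0 : V) r := mem_closedBall_zero_iff.2 h
      have h3 := hM' (R y) (by rw [hy]; exact h)
      have h4 := hg_nonneg (R y)
      dsimp only
      rw [Set.indicator_of_mem h2]
      by_cases hl : R y ∈ L
      · rw [Set.indicator_of_mem hl]; exact h3
      · rw [Set.indicator_of_notMem hl]; linarith
    · have h2 : y ∉ Metric.closedBall (0 : V) r := fun h2 => h (mem_closedBall_zero_iff.1 h2)
      have h3 : R y ∉ L := fun hl => h (by rw [← hy]; exact hKr _ (hLK hl))
      dsimp only
      rw [Set.indicator_of_notMem h2, Set.indicator_of_notMem h3]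
  have hleS : ∀ R : EuclideanSpace ℝ (Fin n) →L[ℝ] EuclideanSpace ℝ (Fin n),
      (∀ x, ‖R x‖ = ‖x‖) → ∫ y : V, L.indicator g (R y) ∂ν ≤ S := by
    intro R hR
    rw [← st_section _ hd e R hR L hL g]
    exact le_ciSup hbdd ⟨R e, by simp [hR, he]⟩
  have hS0 : 0 ≤ S := by
    refine Real.iSup_nonneg fun ξ => integral_nonneg fun x => hg_nonneg x
  -- the main estimate
  have key : ∀ δ : ℝ, 0 < δ → ∫ x in L, g x ≤ C * (S + δ) + 2 * δ := by
    intro δ hδ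
    let N : Set (EuclideanSpace ℝ (Fin n)) := Neg.neg ⁻¹' K
    have hNcl : IsClosed N := hKcompact.isClosed.preimage continuous_neg
    obtain ⟨A, hAP, hA, hAint⟩ := st_inner K (L ∩ N) hKcompact
      (hL.inter hNcl.measurableSet) (Set.inter_subset_left.trans hLK) g hg_cont δ hδ
    obtain ⟨B, hBP, hB, hBint⟩ := st_inner K (L \ N) hKcompact
      (hL.diff hNcl.measurableSet) (Set.sdiff_subset.trans hLK) g hg_cont δ hδ
    have hsplit := integral_inter_add_sdiff (μ := volume) (f := g) hNcl.measurableSet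
      ((hg_cont.continuousOn.integrableOn_compact hKcompact).mono_set hLK)
    have hA1 : ∀ x, x ∈ A → x ∈ K := fun x hx => hLK (hAP hx).1
    have hA2 : ∀ x, -x ∈ A → x ∈ K := fun x hx => by
      have := Set.mem_preimage.1 (hAP hx).2
      rwa [neg_neg] at this
    have hB1 : ∀ x, x ∈ B → x ∈ K := fun x hx => hLK (hBP hx).1
    have hB2 : ∀ x, -x ∈ B → x ∉ K := fun x hx hxK => by
      refine (hBP hx).2 (Set.mem_preimage.2 ?_)
      rwa [neg_neg]
    have hAB : ∀ x, x ∈ A → x ∉ B := fun x hx hx' => (hBP hx').2 (hAP hx).2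
    obtain ⟨a, ha, ha0, ha1, haA, haanti, halim, -⟩ := st_approx A hA.isClosed
    obtain ⟨b, hbc, hb0, hb1, hbB, hbanti, hblim, -⟩ := st_approx B hB.isClosed
    obtain ⟨p, hp, hp0, hp1, hpK, hpanti, hplim, hpz⟩ := st_approx K hKcompact.isClosed
    let q : ℕ → EuclideanSpace ℝ (Fin n) → ℝ := fun k x =>
      (a k x + a k (-x)) / 2 + b k x + b k (-x)
    let u : ℕ → EuclideanSpace ℝ (Fin n) → ℝ := fun k x => g x * q k x
    have hq0 : ∀ k x, 0 ≤ q k x := fun k x => by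
      have := ha0 k x; have := ha0 k (-x); have := hb0 k x; have := hb0 k (-x)
      simp only [q]; linarith
    have hq3 : ∀ k x, q k x ≤ 3 := fun k x => by
      have := ha1 k x; have := ha1 k (-x); have := hb1 k x; have := hb1 k (-x)
      simp only [q]; linarith
    have hqanti : ∀ x, Antitone fun k => q k x := fun x i j hij => by
      have h1 := haanti x hij; have h2 := haanti (-x) hij
      have h3 := hbanti x hij; have h4 := hbanti (-x) hij
      simp only [q] at *; linarith
    have hqc : ∀ k, Continuous (q k) := fun k => by
      have := ha k; have := hbc k
      simp only [q]; fun_prop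
    have huc : ∀ k, Continuous (u k) := fun k => hg_cont.mul (hqc k)
    have hu0 : ∀ k x, 0 ≤ u k x := fun k x => mul_nonneg (hg_nonneg x) (hq0 k x)
    have hueven : ∀ k x, u k (-x) = u k x := fun k x => by
      simp only [u, q, hg_even, neg_neg]; ring
    let v : ℕ → EuclideanSpace ℝ (Fin n) → ℝ := fun k x => u k x * p k x
    have hv0 : ∀ k x, 0 ≤ v k x := fun k x => mul_nonneg (hu0 k x) (hp0 k x)
    let w : EuclideanSpace ℝ (Fin n) → ℝ := fun x =>
      (A.indicator g x + A.indicator g (-x)) / 2 + B.indicator g x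
    have hwlim : ∀ x, Filter.Tendsto (fun k => v k x) Filter.atTop (nhds (w x)) := by
      intro x
      have h := ((((((halim x).add (halim (-x))).div_const 2).add (hblim x)).add
        (hblim (-x))).const_mul (g x)).mul (hplim x)
      have hw : w x = g x * ((A.indicator 1 x + A.indicator 1 (-x)) / 2 + B.indicator 1 x +
          B.indicator 1 (-x)) * K.indicator 1 x := by
        have i1 := hA1 x
        have i2 := hA2 x
        have i3 := hB1 x
        have i4 := hB2 x
        simp only [w, Set.indicator_apply, hg_even, Pi.one_apply]
        by_cases hxK : x ∈ K
        · have j4 : -x ∉ B := fun h => i4 h hxK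
          simp only [hxK, j4, if_true, if_false]
          split_ifs <;> ring
        · have j1 : x ∉ A := fun h => hxK (i1 h)
          have j2 : -x ∉ A := fun h => hxK (i2 h)
          have j3 : x ∉ B := fun h => hxK (i3 h)
          simp [hxK, j1, j2, j3]
      rw [hw]
      exact h
    have hwS : ∀ R : EuclideanSpace ℝ (Fin n) →L[ℝ] EuclideanSpace ℝ (Fin n),
        (∀ x, ‖R x‖ = ‖x‖) → ∫ y : V, w (R y) ∂ν ≤ S := by
      intro R hR
      have iA := hLint R hR A hA.measurableSet hA1
      have iB := hLint R hR B hB.measurableSet hB1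
      have iA' : Integrable (fun y : V => A.indicator g (-(R y))) ν := by
        have := iA.comp_neg
        refine this.congr (Filter.Eventually.of_forall fun y => ?_)
        simp
      have e1 : ∫ y : V, A.indicator g (-(R y)) ∂ν = ∫ y : V, A.indicator g (R y) ∂ν := by
        rw [← integral_neg_eq_self (fun y : V => A.indicator g (R y)) ν]
        simp
      have e2 : ∫ y : V, w (R y) ∂ν
          = (∫ y : V, A.indicator g (R y) ∂ν) + ∫ y : V, B.indicator g (R y) ∂ν := by
        simp only [w]
        have h1 : Integrable (fun y : V =>
            (A.indicator g (R y) + A.indicator g (-(R y))) / 2) ν := (iA.add iA').div_const 2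
        rw [integral_add h1 iB, integral_div, integral_add iA iA', e1]
        ring
      rw [e2, ← integral_add iA iB]
      refine le_trans (integral_mono (iA.add iB) (hLint R hR L hL hLK) fun y => ?_) (hleS R hR)
      have i1 := hAB (R y)
      have i2 : R y ∈ A → R y ∈ L := fun h => (hAP h).1
      have i3 : R y ∈ B → R y ∈ L := fun h => (hBP h).1
      have i4 := hg_nonneg (R y)
      simp only [Pi.add_apply, Set.indicator_apply]
      split_ifs <;> first | linarith | (exfalso; tauto)
    obtain ⟨k, hk⟩ := st_dini V ν v (fun k => (huc k).mul (hp k))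
      (fun x i j hij => by
        simp only [v, u]
        exact mul_le_mul (mul_le_mul_of_nonneg_left (hqanti x hij) (hg_nonneg x))
          (hpanti x hij) (hp0 _ _) (hu0 i x))
      w hwlim (M * 3) r
      (fun k x => by
        rw [Real.norm_eq_abs, abs_of_nonneg (hv0 k x)]
        by_cases hx : ‖x‖ ≤ r
        · rw [Set.indicator_of_mem (mem_closedBall_zero_iff.2 hx)]
          have h1 : u k x ≤ M * 3 :=
            mul_le_mul (hM' x hx) (hq3 k x) (hq0 k x) ((hg_nonneg x).trans (hM' x hx))
          have h2 : v k x ≤ u k x := mul_le_of_le_one_right (hu0 k x) (hp1 k x)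
          linarith
        · rw [Set.indicator_of_notMem (fun h => hx (mem_closedBall_zero_iff.1 h))]
          have : p k x = 0 := hpz k x fun h => hx (hr x h)
          simp [v, this])
      S hwS δ hδ
    have hst := hstab (fun x => 1 + u k x) (continuous_const.add (huc k))
      (fun x => by rw [hueven]) (fun x _ => by linarith [hu0 k x]) (S + δ) (by linarith)
      (by
        intro ξ hξ
        obtain ⟨R, hR, rfl⟩ := hrot ξ hξ
        have m1 := st_section _ hd e R hR K hKm (fun _ => (1 : ℝ))
        rw [setIntegral_const, smul_eq_mul, mul_one] at m1
        have i1 := st_int V ν R hR K hKm r hKr (fun _ => (1 : ℝ)) continuous_const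
        have i2 := st_int V ν R hR K hKm r hKr (u k) (huc k)
        have i3 := st_int V ν R hR (Metric.closedBall 0 r) measurableSet_closedBall r
          (fun x hx => mem_closedBall_zero_iff.1 hx) (v k) ((huc k).mul (hp k))
        have i3' : Integrable (fun y : V => v k (R y)) ν := by
          refine i3.congr (Filter.Eventually.of_forall fun y => ?_)
          dsimp only
          by_cases hx : ‖R y‖ ≤ r
          · rw [Set.indicator_of_mem (mem_closedBall_zero_iff.2 hx)]
          · rw [Set.indicator_of_notMem (fun h => hx (mem_closedBall_zero_iff.1 h))]
            have : p k (R y) = 0 := hpz k _ fun h => hx (hr _ h)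
            simp [v, this]
        rw [st_section _ hd e R hR K hKm (fun x => 1 + u k x)]
        have m2 : ∫ y : V, K.indicator (fun x => 1 + u k x) (R y) ∂ν
            = (∫ y : V, K.indicator (fun _ => (1 : ℝ)) (R y) ∂ν)
              + ∫ y : V, K.indicator (u k) (R y) ∂ν := by
          rw [← integral_add i1 i2]
          refine integral_congr_ae (Filter.Eventually.of_forall fun y => ?_)
          simp only [Set.indicator_apply]
          split_ifs <;> simp
        have m3 : ∫ y : V, K.indicator (u k) (R y) ∂ν ≤ ∫ y : V, v k (R y) ∂ν := by
          refine integral_mono i2 i3' fun y => ?_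
          by_cases h : R y ∈ K
          · simp [h, v, hpK k _ h]
          · have := hv0 k (R y)
            simpa [h] using this
        have m4 := hk R hR
        have m5 : (μH[(n : ℝ) - 1] (K ∩ {x | ⟪x, R e⟫ = 0})).toReal
          = ∫ y : V, K.indicator (fun _ => (1 : ℝ)) (R y) ∂ν := m1
        rw [m2, m5]
        linarith)
    have iu : IntegrableOn (u k) K := (huc k).continuousOn.integrableOn_compact hKcompact
    have hKfin : volume K ≠ ⊤ := hKcompact.measure_lt_top.ne
    have i1 : Integrable (fun _ : EuclideanSpace ℝ (Fin n) => (1 : ℝ)) (volume.restrict K) :=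
      continuousOn_const.integrableOn_compact hKcompact
    rw [integral_add i1 iu, setIntegral_const, smul_eq_mul,
      mul_one] at hst
    have hst2 : ∫ x in K, u k x ≤ C * (S + δ) := by
      have : volume.real K = (volume K).toReal := rfl
      linarith
    have jA : Integrable (A.indicator g) :=
      (integrable_indicator_iff hA.measurableSet).2
        (hg_cont.continuousOn.integrableOn_compact hA)
    have jB : Integrable (B.indicator g) :=
      (integrable_indicator_iff hB.measurableSet).2
        (hg_cont.continuousOn.integrableOn_compact hB)
    have jA' : Integrable (fun x => A.indicator g (-x)) := jA.comp_neg
    have e2 : ∫ x, w x = (∫ x in A, g x) + ∫ x in B, g x := by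
      rw [← integral_indicator hA.measurableSet, ← integral_indicator hB.measurableSet]
      simp only [w]
      have h1 : Integrable (fun x => (A.indicator g x + A.indicator g (-x)) / 2) :=
        (jA.add jA').div_const 2
      rw [integral_add h1 jB, integral_div, integral_add jA jA',
        integral_neg_eq_self (A.indicator g) volume]
      ring
    have e3 : ∫ x, w x ≤ ∫ x in K, u k x := by
      rw [← integral_indicator hKm]
      refine integral_mono (((jA.add jA').div_const 2).add jB)
        ((integrable_indicator_iff hKm).2 iu) fun x => ?_
      have hanti' : Antitone fun m => v m x := fun i j hij =>
        mul_le_mul (mul_le_mul_of_nonneg_left (hqanti x hij) (hg_nonneg x))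
          (hpanti x hij) (hp0 _ _) (hu0 i x)
      have h1 : w x ≤ v k x := hanti'.le_of_tendsto (hwlim x) k
      by_cases hxK : x ∈ K
      · rw [Set.indicator_of_mem hxK]
        exact h1.trans (mul_le_of_le_one_right (hu0 k x) (hp1 k x))
      · have j1 : x ∉ A := fun h => hxK (hA1 x h)
        have j2 : -x ∉ A := fun h => hxK (hA2 x h)
        have j3 : x ∉ B := fun h => hxK (hB1 x h)
        simp [w, hxK, j1, j2, j3]
    linarith
  refine le_of_forall_pos_le_add fun δ hδ => ?_
  have hpos : 0 < δ / (|C| + 2) := by positivity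
  have h := key _ hpos
  have h2 : (|C| + 2) * (δ / (|C| + 2)) = δ := by field_simp
  have h3 : C * (δ / (|C| + 2)) ≤ |C| * (δ / (|C| + 2)) :=
    mul_le_mul_of_nonneg_right (le_abs_self C) hpos.le
  linarith
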